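/- For all first-order models 𝔐 with domain M, teams X over 𝔐, and first-order formulas ξ(v̄, z̄) over the empty signature with v̄ contained in the variables of the domain of X: 𝔐 ⊨_X ⊤ ∨ ∃z̄ (All(z̄) ∧ ¬ξ(v̄, z̄)) if and only if (M, R := X(v̄)) ⊨ ¬∃z̄ ∀x̄ (R x̄ → ξ(x̄, z̄)). -/

import Mathlib

namespace DSFO

/-- A purely relational signature: for each arity, a type of relation symbols. -/
abbrev Signature := ℕ → Type

/-- The empty signature. -/
def Sig0 : Signature := fun _ => Empty

/-- The signature with a single `k`-ary relation symbol `R`. -/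
def SigR (k : ℕ) : Signature := fun n => PLift (n = k)

/-- Syntax of team-semantics formulas (in negation normal form, with the two
additional connectives: global disjunction `gdisj` and contradictory negation
`cneg`) over a relational signature `S`, with generalized dependency atoms
indexed by `ι` with arities `ar`.  Variables are natural numbers. -/
inductive TS (S : Signature) (ι : Type) (ar : ι → ℕ) : Type
  | rel {k : ℕ} (r : S k) (v : Fin k → ℕ)
  | nrel {k : ℕ} (r : S k) (v : Fin k → ℕ)
  | eq (x y : ℕ)
  | neq (x y : ℕ)
  | dep (i : ι) (v : Fin (ar i) → ℕ)
  | and (φ ψ : TS S ι ar)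
  | or (φ ψ : TS S ι ar)
  | gdisj (φ ψ : TS S ι ar)
  | cneg (φ : TS S ι ar)
  | ex (v : ℕ) (φ : TS S ι ar)
  | al (v : ℕ) (φ : TS S ι ar)

/-- The always-true literal `⊤`. -/
def TS.top {S : Signature} {ι : Type} {ar : ι → ℕ} : TS S ι ar := .eq 0 0

/-- The arity function for "no dependency atoms". -/
def noAtoms : Empty → ℕ := fun e => e.elim

/-- First-order formulas over `S` (no dependency atoms; here `cneg` plays the
role of ordinary classical negation and `gdisj` of ordinary disjunction, so
this is full first-order logic). -/
abbrev FOF (S : Signature) := TS S Empty noAtoms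

/-- First-order formulas over the empty signature. -/
abbrev EF := FOF Sig0

/-- Free variables of a formula. -/
def fv {S : Signature} {ι : Type} {ar : ι → ℕ} : TS S ι ar → Set ℕ
  | .rel _ v => Set.range v
  | .nrel _ v => Set.range v
  | .eq x y => {x, y}
  | .neq x y => {x, y}
  | .dep _ v => Set.range v
  | .and φ ψ => fv φ ∪ fv ψ
  | .or φ ψ => fv φ ∪ fv ψ
  | .gdisj φ ψ => fv φ ∪ fv ψ
  | .cneg φ => fv φ
  | .ex v φ => fv φ \ {v}
  | .al v φ => fv φ \ {v}

/-- A sentence is a formula with no free variables. -/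
def IsSentence {S : Signature} {ι : Type} {ar : ι → ℕ} (φ : TS S ι ar) : Prop :=
  fv φ = ∅

/-- No global disjunctions occur. -/
def NoGdisj {S : Signature} {ι : Type} {ar : ι → ℕ} : TS S ι ar → Prop
  | .rel _ _ => True
  | .nrel _ _ => True
  | .eq _ _ => True
  | .neq _ _ => True
  | .dep _ _ => True
  | .and φ ψ => NoGdisj φ ∧ NoGdisj ψ
  | .or φ ψ => NoGdisj φ ∧ NoGdisj ψ
  | .gdisj _ _ => False
  | .cneg φ => NoGdisj φ
  | .ex _ φ => NoGdisj φ
  | .al _ φ => NoGdisj φ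

/-- No contradictory negations occur. -/
def NoCneg {S : Signature} {ι : Type} {ar : ι → ℕ} : TS S ι ar → Prop
  | .rel _ _ => True
  | .nrel _ _ => True
  | .eq _ _ => True
  | .neq _ _ => True
  | .dep _ _ => True
  | .and φ ψ => NoCneg φ ∧ NoCneg ψ
  | .or φ ψ => NoCneg φ ∧ NoCneg ψ
  | .gdisj φ ψ => NoCneg φ ∧ NoCneg ψ
  | .cneg _ => False
  | .ex _ φ => NoCneg φ
  | .al _ φ => NoCneg φ

/-- Formulas of `FO(𝒟)` proper: no `gdisj` and no `cneg`. -/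
def Plain {S : Signature} {ι : Type} {ar : ι → ℕ} (φ : TS S ι ar) : Prop :=
  NoCneg φ ∧ NoGdisj φ

/-- Atomic formulas: first-order literals and dependency atoms. -/
def Atomic {S : Signature} {ι : Type} {ar : ι → ℕ} : TS S ι ar → Prop
  | .rel _ _ => True
  | .nrel _ _ => True
  | .eq _ _ => True
  | .neq _ _ => True
  | .dep _ _ => True
  | _ => False

/-- Formulas of `FO(∼₀, 𝒟)`: the contradictory negation may appear only in
front of first-order literals and dependency atoms (and there is no `gdisj`). -/
def Cneg0 {S : Signature} {ι : Type} {ar : ι → ℕ} : TS S ι ar → Prop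
  | .rel _ _ => True
  | .nrel _ _ => True
  | .eq _ _ => True
  | .neq _ _ => True
  | .dep _ _ => True
  | .and φ ψ => Cneg0 φ ∧ Cneg0 ψ
  | .or φ ψ => Cneg0 φ ∧ Cneg0 ψ
  | .gdisj _ _ => False
  | .cneg φ => Atomic φ
  | .ex _ φ => Cneg0 φ
  | .al _ φ => Cneg0 φ

/-- The negation normal form of the (dual) negation of a formula. -/
def TS.nneg {S : Signature} {ι : Type} {ar : ι → ℕ} : TS S ι ar → TS S ι ar
  | .rel r v => .nrel r v
  | .nrel r v => .rel r v
  | .eq x y => .neq x y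
  | .neq x y => .eq x y
  | .dep i v => .cneg (.dep i v)
  | .and φ ψ => .or (TS.nneg φ) (TS.nneg ψ)
  | .or φ ψ => .and (TS.nneg φ) (TS.nneg ψ)
  | .gdisj φ ψ => .and (TS.nneg φ) (TS.nneg ψ)
  | .cneg φ => φ
  | .ex v φ => .al v (TS.nneg φ)
  | .al v φ => .ex v (TS.nneg φ)

/-- Iterated existential quantification over a list of variables. -/
def exs {S : Signature} {ι : Type} {ar : ι → ℕ} (l : List ℕ) (φ : TS S ι ar) :
    TS S ι ar := l.foldr TS.ex φ

/-- An interpretation of a relational signature in a domain `M`. -/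
abbrev Interp (S : Signature) (M : Type) := ∀ k, S k → Set (Fin k → M)

/-- The unique interpretation of the empty signature. -/
def eI (M : Type) : Interp Sig0 M := fun _ e => e.elim

/-- The interpretation of `SigR k` given by a `k`-ary relation `R`. -/
def interpR {k : ℕ} {M : Type} (R : Set (Fin k → M)) : Interp (SigR k) M :=
  fun _ r => {s | (fun i => s (Fin.cast r.down.symm i)) ∈ R}

/-- Tarskian (single-assignment) satisfaction.  Dependency atoms are
(vacuously) interpreted as true; this is only used on first-order formulas. -/
def FSat {S : Signature} {ι : Type} {ar : ι → ℕ} (M : Type) (I : Interp S M) :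
    (ℕ → M) → TS S ι ar → Prop
  | s, .rel r v => (fun i => s (v i)) ∈ I _ r
  | s, .nrel r v => (fun i => s (v i)) ∉ I _ r
  | s, .eq x y => s x = s y
  | s, .neq x y => s x ≠ s y
  | _, .dep _ _ => True
  | s, .and φ ψ => FSat M I s φ ∧ FSat M I s ψ
  | s, .or φ ψ => FSat M I s φ ∨ FSat M I s ψ
  | s, .gdisj φ ψ => FSat M I s φ ∨ FSat M I s ψ
  | s, .cneg φ => ¬ FSat M I s φ
  | s, .ex v φ => ∃ m : M, FSat M I (Function.update s v m) φ
  | s, .al v φ => ∀ m : M, FSat M I (Function.update s v m) φ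

/-- Truth of a first-order sentence (Tarskian semantics). -/
def FOTrue {S : Signature} {ι : Type} {ar : ι → ℕ} (M : Type) (I : Interp S M)
    (φ : TS S ι ar) : Prop :=
  ∀ s : ℕ → M, FSat M I s φ

/-- The relation `X(x̄)` determined by a team `X` and a tuple of variables `x̄`. -/
def teamProj {M : Type} {k : ℕ} (v : Fin k → ℕ) (X : Set (ℕ → M)) :
    Set (Fin k → M) := {t | ∃ s ∈ X, t = fun j => s (v j)}

/-- (Lax) team semantics.  `A` gives the semantics of each dependency atom as a
function of the relation `X(x̄)`. -/
def TSat {S : Signature} {ι : Type} {ar : ι → ℕ} (M : Type) (I : Interp S M)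
    (A : ∀ i, Set (Fin (ar i) → M) → Prop) :
    TS S ι ar → Set (ℕ → M) → Prop
  | .rel r v, X => ∀ s ∈ X, (fun i => s (v i)) ∈ I _ r
  | .nrel r v, X => ∀ s ∈ X, (fun i => s (v i)) ∉ I _ r
  | .eq x y, X => ∀ s ∈ X, s x = s y
  | .neq x y, X => ∀ s ∈ X, s x ≠ s y
  | .dep i v, X => A i (teamProj v X)
  | .and φ ψ, X => TSat M I A φ X ∧ TSat M I A ψ X
  | .or φ ψ, X => ∃ Y Z : Set (ℕ → M), Y ∪ Z = X ∧ TSat M I A φ Y ∧ TSat M I A ψ Z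
  | .gdisj φ ψ, X => TSat M I A φ X ∨ TSat M I A ψ X
  | .cneg φ, X => ¬ TSat M I A φ X
  | .ex v φ, X => ∃ H : (ℕ → M) → Set M, (∀ s ∈ X, (H s).Nonempty) ∧
      TSat M I A φ {s' | ∃ s ∈ X, ∃ m ∈ H s, s' = Function.update s v m}
  | .al v φ, X => TSat M I A φ {s' | ∃ s ∈ X, ∃ m : M, s' = Function.update s v m}

/-- Truth of a sentence under team semantics: satisfaction by the team of all
assignments (by locality, equivalent to satisfaction by `{∅}`). -/
def TTrue {S : Signature} {ι : Type} {ar : ι → ℕ} (M : Type) (I : Interp S M)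
    (A : ∀ i, Set (Fin (ar i) → M) → Prop) (φ : TS S ι ar) : Prop :=
  TSat M I A φ Set.univ

/-- A `k`-ary dependency predicate: a class of pairs `(M, R)`. -/
abbrev DepPred (k : ℕ) := ∀ M : Type, Set (Fin k → M) → Prop

/-- Closure under isomorphisms (part of the definition of a generalized
dependency). -/
def IsoClosed {k : ℕ} (D : DepPred k) : Prop :=
  ∀ (M N : Type) (e : M ≃ N) (R : Set (Fin k → M)),
    D M R → D N ((fun f => e ∘ f) '' R)

/-- The complement `∼D` of a dependency. -/
def complD {k : ℕ} (D : DepPred k) : DepPred k := fun M R => ¬ D M R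

def DownwardsClosed {k : ℕ} (D : DepPred k) : Prop :=
  ∀ (M : Type) (R R' : Set (Fin k → M)), D M R → R' ⊆ R → D M R'

/-- The downwards closure `D↓`. -/
def dClosure {k : ℕ} (D : DepPred k) : DepPred k :=
  fun M R => ∃ R', R ⊆ R' ∧ D M R'

/-- `D_max`: the maximal models of `D`. -/
def DMax {k : ℕ} (D : DepPred k) : DepPred k :=
  fun M R => D M R ∧ ∀ R', R ⊂ R' → ¬ D M R'

/-- The empty team property. -/
def EmptyTeamProp {k : ℕ} (D : DepPred k) : Prop :=
  ∀ M : Type, Nontrivial M → D M (∅ : Set (Fin k → M))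

/-- `D` is a first-order dependency: it is the class of models of a first-order
sentence over the signature `{R}`. -/
def FirstOrderDep {k : ℕ} (D : DepPred k) : Prop :=
  ∃ ψ : FOF (SigR k), IsSentence ψ ∧
    ∀ (M : Type), Nontrivial M → ∀ R : Set (Fin k → M),
      (D M R ↔ FOTrue M (interpR R) ψ)

/-- The interpretation of a unary predicate symbol as a subset of the domain. -/
def PSet {S : Signature} {M : Type} (I : Interp S M) (P : S 1) : Set M :=
  {m | (fun _ => m) ∈ I 1 P}

/-- Semantics of the relativization `D^(P)` of `D` to the unary predicate `P`:
`𝔐 ⊨_X D^(P) x̄` iff `(P^𝔐, X(x̄)) ∈ D`. -/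
def relSem {k : ℕ} (D : DepPred k) {S : Signature} (P : S 1)
    (M : Type) (I : Interp S M) (R : Set (Fin k → M)) : Prop :=
  (∀ f ∈ R, ∀ j, f j ∈ PSet I P) ∧
    D (↥(PSet I P)) {g : Fin k → ↥(PSet I P) | (fun j => (g j : M)) ∈ R}

/-- A family `𝒟` of generalized dependencies is strongly first order: every
sentence of `FO(𝒟)` is equivalent to some first-order sentence. -/
def SFOFam {ι : Type} {ar : ι → ℕ} (D : ∀ i, DepPred (ar i)) : Prop :=
  ∀ (S : Signature) (φ : TS S ι ar), IsSentence φ → Plain φ →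
    ∃ ψ : FOF S, IsSentence ψ ∧
      ∀ (M : Type), Nontrivial M → ∀ I : Interp S M,
        (TTrue M I (fun i => D i M) φ ↔ FOTrue M I ψ)

/-- A single dependency is strongly first order iff `{D}` is. -/
def SFOd {k : ℕ} (D : DepPred k) : Prop :=
  SFOFam (ι := Unit) (ar := fun _ => k) (fun _ => D)

/-- A family `𝒟` is relativizable: every sentence of `FO(𝒟^(P))` is equivalent
to some sentence of `FO(𝒟)`. -/
def RelativizableFam {ι : Type} {ar : ι → ℕ} (D : ∀ i, DepPred (ar i)) : Prop :=
  ∀ (S : Signature) (P : S 1) (φ : TS S ι ar), IsSentence φ → Plain φ →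
    ∃ ψ : TS S ι ar, IsSentence ψ ∧ Plain ψ ∧
      ∀ (M : Type), Nontrivial M → ∀ I : Interp S M,
        (TTrue M I (fun i => relSem (D i) P M I) φ ↔ TTrue M I (fun i => D i M) ψ)

def Relativizable1 {k : ℕ} (D : DepPred k) : Prop :=
  RelativizableFam (ι := Unit) (ar := fun _ => k) (fun _ => D)

/-- The family `𝒟 ∪ ∼𝒟`. -/
def withComplFam {ι : Type} {ar : ι → ℕ} (D : ∀ i, DepPred (ar i)) :
    ∀ i : ι ⊕ ι, DepPred (Sum.elim ar ar i) :=
  fun i => match i with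
    | .inl a => D a
    | .inr a => complD (D a)

/-- `D` is doubly strongly first order: `{D, ∼D}` is strongly first order. -/
def DSFOd {k : ℕ} (D : DepPred k) : Prop :=
  SFOFam (ι := Bool) (ar := fun _ => k)
    (fun b => match b with | true => D | false => complD D)

/-- The constancy atom of arity `k`. -/
def constD (k : ℕ) : DepPred k := fun _ R => ∀ f ∈ R, ∀ g ∈ R, f = g

/-- The totality atom of arity `k`. -/
def allD (k : ℕ) : DepPred k := fun M R => R = (Set.univ : Set (Fin k → M))

/-- The family `𝒟 ∪ {const}` (constancy atoms of every arity). -/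
def withConst {ι : Type} {ar : ι → ℕ} (D : ∀ i, DepPred (ar i)) :
    ∀ i : ι ⊕ ℕ, DepPred (Sum.elim ar id i) :=
  fun i => match i with
    | .inl a => D a
    | .inr n => constD n

/-- The atoms of `𝒟^(P) ∪ {const}`. -/
def withConstRel {ι : Type} {ar : ι → ℕ} (D : ∀ i, DepPred (ar i))
    {S : Signature} (P : S 1) (M : Type) (I : Interp S M) :
    ∀ i : ι ⊕ ℕ, Set (Fin (Sum.elim ar id i) → M) → Prop :=
  fun i => match i with
    | .inl a => relSem (D a) P M I
    | .inr n => constD n M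

/-- Atom indices of the logic `FO(𝒟₀, ⊔, const, All)`: the 0-ary first-order
dependencies `[ψ]`, the constancy atoms and the totality atoms. -/
inductive CIdx : Type
  | d0 (ψ : EF) (hψ : IsSentence ψ)
  | const (k : ℕ)
  | total (k : ℕ)

def cAr : CIdx → ℕ
  | .d0 _ _ => 0
  | .const k => k
  | .total k => k

def cSem (M : Type) : ∀ i : CIdx, Set (Fin (cAr i) → M) → Prop
  | .d0 ψ _, _ => FOTrue M (eI M) ψ
  | .const _, R => ∀ f ∈ R, ∀ g ∈ R, f = g
  | .total _, R => R = Set.univ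

/-- Embedding of first-order formulas over the empty signature into any
team logic. -/
def embedEF {S : Signature} {ι : Type} {ar : ι → ℕ} : EF → TS S ι ar
  | .rel r _ => Empty.elim r
  | .nrel r _ => Empty.elim r
  | .eq x y => .eq x y
  | .neq x y => .neq x y
  | .dep i _ => Empty.elim i
  | .and φ ψ => .and (embedEF φ) (embedEF ψ)
  | .or φ ψ => .or (embedEF φ) (embedEF ψ)
  | .gdisj φ ψ => .gdisj (embedEF φ) (embedEF ψ)
  | .cneg φ => .cneg (embedEF φ)
  | .ex v φ => .ex v (embedEF φ)
  | .al v φ => .al v (embedEF φ)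

/-- Override the values of the variables `0, …, k-1` by the tuple `f`. -/
def overrideFin {M : Type} (k : ℕ) (f : Fin k → M) (s : ℕ → M) : ℕ → M :=
  fun v => if h : v < k then f ⟨v, h⟩ else s v

/-- `(M, R) ⊨ ∃ȳ ∀x̄ (R x̄ → θ(x̄, ȳ))`, where `x̄` is the tuple of variables
`0, …, k-1` and the remaining free variables `ȳ` of `θ` are witnessed by `s`. -/
def ExAllSem {k : ℕ} (M : Type) (R : Set (Fin k → M)) (θ : EF) : Prop :=
  ∃ s : ℕ → M, ∀ f ∈ R, FSat M (eI M) (overrideFin k f s) θ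

/-- `(M, R) ⊨ ∃ȳ ∀x̄ (R x̄ ↔ θ(x̄, ȳ))`. -/
def ExAllIffSem {k : ℕ} (M : Type) (R : Set (Fin k → M)) (θ : EF) : Prop :=
  ∃ s : ℕ → M, ∀ f : Fin k → M, (f ∈ R ↔ FSat M (eI M) (overrideFin k f s) θ)

/-- The assignment sending `x̄ = (0, …, k-1)` to `f`, `ȳ = (k, …, k+n-1)` to
`a`, and every other variable to its value under `s0`. -/
def tupAsg {M : Type} (k n : ℕ) (f : Fin k → M) (a : Fin n → M) (s0 : ℕ → M) :
    ℕ → M :=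
  fun v => if h : v < k then f ⟨v, h⟩ else if h2 : v - k < n then a ⟨v - k, h2⟩ else s0 v

/-- `R` is defined by the formula `θ(x̄, ȳ)` (with `x̄ = (0, …, k-1)` and
`ȳ = (k, …, k+n-1)`): there is a tuple `ā` of parameters such that
`R = {m̄ : 𝔐 ⊨ θ(m̄, ā)}`. -/
def DefinedBy {S : Signature} {M : Type} (I : Interp S M) (k n : ℕ)
    (θ : FOF S) (R : Set (Fin k → M)) : Prop :=
  ∃ a : Fin n → M, ∀ s0 : ℕ → M, R = {f | FSat M I (tupAsg k n f a s0) θ}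

/-- `θ(x̄, ȳ)` fixes the identity type of `ȳ = (k, …, k+n-1)`. -/
def FixesIdType {S : Signature} (k n : ℕ) (θ : FOF S) : Prop :=
  ∀ i j : Fin n,
    (∀ (M : Type), Nontrivial M → ∀ (I : Interp S M) (s : ℕ → M),
        FSat M I s θ → s (k + (i : ℕ)) = s (k + (j : ℕ))) ∨
    (∀ (M : Type), Nontrivial M → ∀ (I : Interp S M) (s : ℕ → M),
        FSat M I s θ → s (k + (i : ℕ)) ≠ s (k + (j : ℕ)))

/-- `(M, R := Xv) ⊨ ∃ȳ ∀x̄ (R x̄ → θ(x̄, ȳ))` where the `x̄`-slots of `θ` are the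
variables `v̄` and the `ȳ`-slots are the variables `ȳ`. -/
def projExAll {M : Type} {k n : ℕ} (v : Fin k → ℕ) (y : Fin n → ℕ) (θ : EF)
    (Xv : Set (Fin k → M)) : Prop :=
  ∃ b : Fin n → M, ∀ f ∈ Xv, ∀ s : ℕ → M,
    (∀ j, s (v j) = f j) → (∀ i, s (y i) = b i) → FSat M (eI M) s θ

/-- Two assignments satisfy the same first-order formulas if they agree on the free variables. -/
theorem FSat_congr {S : Signature} {M : Type} (I : Interp S M) (φ : FOF S) :
    ∀ {s t : ℕ → M}, (∀ x ∈ fv φ, s x = t x) → (FSat M I s φ ↔ FSat M I t φ) := by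
  have update_agree : ∀ {ψ : FOF S} {v : ℕ} {s t : ℕ → M}, (∀ x ∈ fv ψ \ {v}, s x = t x) →
      ∀ m, ∀ x ∈ fv ψ, Function.update s v m x = Function.update t v m x := by
    intro ψ v s t h m x hx
    rcases eq_or_ne x v with rfl | hxv
    · simp
    · simpa [hxv] using h x ⟨hx, hxv⟩
  induction φ with
  | rel r v | nrel r v =>
    intro s t h
    have : (fun i => s (v i)) = fun i => t (v i) := funext fun i => h _ ⟨i, rfl⟩
    simp only [FSat, this]
  | eq x y | neq x y =>
    intro s t h
    simp only [FSat, h x (Or.inl rfl), h y (Or.inr rfl)]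
  | dep i _ => exact i.elim
  | and φ ψ ih₁ ih₂ | or φ ψ ih₁ ih₂ | gdisj φ ψ ih₁ ih₂ =>
    intro s t h
    simp only [FSat, ih₁ fun x hx => h x (Or.inl hx), ih₂ fun x hx => h x (Or.inr hx)]
  | cneg φ ih =>
    intro s t h
    simp only [FSat, ih h]
  | ex v φ ih =>
    intro s t h
    exact exists_congr fun m => ih (update_agree h m)
  | al v φ ih =>
    intro s t h
    exact forall_congr' fun m => ih (update_agree h m)

theorem FSat_nneg {S : Signature} {M : Type} (I : Interp S M) (φ : FOF S) :
    ∀ s : ℕ → M, FSat M I s φ.nneg ↔ ¬ FSat M I s φ := by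
  induction φ with
  | dep i _ => exact i.elim
  | and φ ψ ih₁ ih₂ =>
    intro s
    simp only [TS.nneg, FSat, ih₁, ih₂, not_and_or]
  | _ => simp_all [TS.nneg, FSat]

theorem Plain.nneg {S : Signature} {φ : FOF S} (h : Plain φ) : Plain φ.nneg := by
  induction φ with
  | dep i _ => exact i.elim
  | _ => simp_all [TS.nneg, Plain, NoCneg, NoGdisj]

/-- Flatness of first-order formulas under team semantics. -/
theorem TSat_embedEF {S : Signature} {ι : Type} {ar : ι → ℕ} {M : Type} (I : Interp S M)
    (A : ∀ i, Set (Fin (ar i) → M) → Prop) (φ : EF) :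
    Plain φ → ∀ X : Set (ℕ → M),
      TSat M I A (embedEF φ) X ↔ ∀ s ∈ X, FSat M (eI M) s φ := by
  induction φ with
  | rel r _ | nrel r _ => exact Empty.elim r
  | dep i _ => exact i.elim
  | eq x y | neq x y => exact fun _ _ => Iff.rfl
  | gdisj φ ψ _ _ => exact fun h => h.2.elim
  | cneg φ _ => exact fun h => h.1.elim
  | and φ ψ ih₁ ih₂ =>
    intro h X
    simp only [embedEF, TSat, FSat, ih₁ ⟨h.1.1, h.2.1⟩, ih₂ ⟨h.1.2, h.2.2⟩]
    exact forall₂_and.symm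
  | or φ ψ ih₁ ih₂ =>
    intro h X
    simp only [embedEF, TSat, FSat, ih₁ ⟨h.1.1, h.2.1⟩, ih₂ ⟨h.1.2, h.2.2⟩]
    constructor
    · rintro ⟨Y, Z, rfl, hY, hZ⟩ s (hs | hs)
      · exact Or.inl (hY s hs)
      · exact Or.inr (hZ s hs)
    · intro hX
      refine ⟨{s ∈ X | FSat M (eI M) s φ}, {s ∈ X | FSat M (eI M) s ψ}, ?_,
        fun s hs => hs.2, fun s hs => hs.2⟩
      ext s
      have := hX s
      simp only [Set.mem_union, Set.mem_ofPred_eq]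
      tauto
  | ex v φ ih =>
    intro h X
    simp only [embedEF, TSat, FSat, ih h]
    constructor
    · rintro ⟨H, hne, hH⟩ s hs
      obtain ⟨m, hm⟩ := hne s hs
      exact ⟨m, hH _ ⟨s, hs, m, hm, rfl⟩⟩
    · intro hX
      refine ⟨fun s => {m | FSat M (eI M) (Function.update s v m) φ}, hX, ?_⟩
      rintro _ ⟨s, -, m, hm, rfl⟩
      exact hm
  | al v φ ih =>
    intro h X
    simp only [embedEF, TSat, FSat, ih h]
    constructor
    · exact fun hX s hs m => hX _ ⟨s, hs, m, rfl⟩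
    · rintro hX _ ⟨s, hs, m, rfl⟩
      exact hX s hs m

/-- A team satisfies `∃ l φ` iff some team that differs from it only in the values of the
variables in `l` satisfies `φ`. -/
theorem TSat_exs {S : Signature} {ι : Type} {ar : ι → ℕ} {M : Type} (I : Interp S M)
    (A : ∀ i, Set (Fin (ar i) → M) → Prop) (φ : TS S ι ar) (l : List ℕ) :
    ∀ X : Set (ℕ → M), TSat M I A (exs l φ) X ↔
      ∃ Y : Set (ℕ → M), TSat M I A φ Y ∧ (∀ s ∈ X, ∃ t ∈ Y, ∀ x ∉ l, t x = s x) ∧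
        ∀ t ∈ Y, ∃ s ∈ X, ∀ x ∉ l, t x = s x := by
  induction l with
  | nil =>
    intro X
    constructor
    · exact fun h => ⟨X, h, fun s hs => ⟨s, hs, fun _ _ => rfl⟩,
        fun s hs => ⟨s, hs, fun _ _ => rfl⟩⟩
    · rintro ⟨Y, hY, hXY, hYX⟩
      have : X = Y := by
        ext s
        constructor
        · intro hs
          obtain ⟨t, ht, hts⟩ := hXY s hs
          rwa [← (funext fun x => hts x List.not_mem_nil : t = s)]
        · intro hs
          obtain ⟨t, ht, hst⟩ := hYX s hs
          rwa [(funext fun x => hst x List.not_mem_nil : s = t)]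
      exact this ▸ hY
  | cons v l ih =>
    intro X
    have hcons : exs (v :: l) φ = TS.ex v (exs l φ) := rfl
    simp only [hcons, TSat, ih]
    constructor
    · rintro ⟨H, hne, Y, hY, hXY, hYX⟩
      refine ⟨Y, hY, fun s hs => ?_, fun t ht => ?_⟩
      · obtain ⟨m, hm⟩ := hne s hs
        obtain ⟨t, ht, hts⟩ := hXY _ ⟨s, hs, m, hm, rfl⟩
        refine ⟨t, ht, fun x hx => ?_⟩
        rw [List.mem_cons, not_or] at hx
        simpa [hx.1] using hts x hx.2
      · obtain ⟨_, ⟨s, hs, m, -, rfl⟩, hts⟩ := hYX t ht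
        refine ⟨s, hs, fun x hx => ?_⟩
        rw [List.mem_cons, not_or] at hx
        simpa [hx.1] using hts x hx.2
    · rintro ⟨Y, hY, hXY, hYX⟩
      have agree : ∀ {s t : ℕ → M}, (∀ x ∉ v :: l, t x = s x) →
          ∀ x ∉ l, t x = Function.update s v (t v) x := by
        intro s t h x hx
        rcases eq_or_ne x v with rfl | hxv
        · simp
        · simpa [hxv] using h x (by simp [hxv, hx])
      refine ⟨fun s => {m | ∃ t ∈ Y, ∀ x ∉ l, t x = Function.update s v m x},
        fun s hs => ?_, Y, hY, ?_, fun t ht => ?_⟩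
      · obtain ⟨t, ht, hts⟩ := hXY s hs
        exact ⟨t v, t, ht, agree hts⟩
      · rintro _ ⟨s, -, m, hm, rfl⟩
        exact hm
      · obtain ⟨s, hs, hts⟩ := hYX t ht
        exact ⟨_, ⟨s, hs, t v, ⟨t, ht, agree hts⟩, rfl⟩, agree hts⟩

/-- `𝔐 ⊨_X ⊤ ∨ ∃z̄ (All(z̄) ∧ ¬ξ(v̄, z̄))` iff
`(M, R := X(v̄)) ⊨ ¬∃z̄ ∀x̄ (R x̄ → ξ(x̄, z̄))`, for `ξ` a first-order formula over
the empty signature (in negation normal form, `¬ξ` denoting its NNF negation). -/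
theorem total_exists_negxi_lemma (S : Signature) (M : Type) [Nontrivial M]
    (I : Interp S M) {k n : ℕ} (v : Fin k → ℕ) (z : Fin n → ℕ)
    (hz : Function.Injective z) (hvz : ∀ i j, z i ≠ v j)
    (ξ : EF) (hξ : Plain ξ) (hfv : fv ξ ⊆ Set.range v ∪ Set.range z)
    (X : Set (ℕ → M)) :
    TSat M I (cSem M)
        (TS.or TS.top
          (exs (List.ofFn z) (TS.and (TS.dep (CIdx.total n) z) (embedEF (TS.nneg ξ))))) X
    ↔ ¬ projExAll v z ξ (teamProj v X) := by
  have flat := TSat_embedEF I (cSem M) ξ.nneg hξ.nneg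
  have notMem_v : ∀ j, v j ∉ List.ofFn z := by
    intro j hj
    obtain ⟨i, hi⟩ := (List.mem_ofFn' z _).1 hj
    exact hvz i j hi
  constructor
  · rintro ⟨Y, Z, rfl, -, hZ⟩ ⟨b, hb⟩
    obtain ⟨W, ⟨hall, hneg⟩, -, hWZ⟩ := (TSat_exs I (cSem M) _ _ _).1 hZ
    obtain ⟨t, ht, hbt⟩ : b ∈ teamProj z W := by
      have hW : teamProj z W = Set.univ := hall
      exact hW ▸ Set.mem_univ b
    obtain ⟨s, hs, hts⟩ := hWZ t ht
    refine (FSat_nneg (eI M) ξ t).1 ((flat W).1 hneg t ht)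
      (hb _ ⟨s, Or.inr hs, rfl⟩ t (fun j => hts _ (notMem_v j)) fun i => ?_)
    rw [hbt]
  · intro hX
    let W : Set (ℕ → M) :=
      {t | (∃ s ∈ X, ∀ x ∉ List.ofFn z, t x = s x) ∧ ¬ FSat M (eI M) t ξ}
    refine ⟨X, {s ∈ X | ∃ t ∈ W, ∀ x ∉ List.ofFn z, t x = s x},
      Set.union_eq_left.2 fun s hs => hs.1, fun s _ => rfl, ?_⟩
    refine (TSat_exs I (cSem M) _ _ _).2 ⟨W, ⟨?_, ?_⟩, fun s hs => hs.2, fun t ht => ?_⟩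
    · change teamProj z W = Set.univ
      refine Set.eq_univ_of_forall fun b => ?_
      have hb : ¬ ∀ f ∈ teamProj v X, ∀ s : ℕ → M, (∀ j, s (v j) = f j) →
          (∀ i, s (z i) = b i) → FSat M (eI M) s ξ := fun h => hX ⟨b, h⟩
      push Not at hb
      obtain ⟨_, ⟨s, hs, rfl⟩, s', hv, hz', hns⟩ := hb
      classical
      let t : ℕ → M := fun x => if x ∈ List.ofFn z then s' x else s x
      have htz : ∀ i, t (z i) = s' (z i) := fun i =>
        if_pos ((List.mem_ofFn' z _).2 ⟨i, rfl⟩)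
      have htv : ∀ j, t (v j) = s' (v j) := fun j =>
        (if_neg (notMem_v j)).trans (hv j).symm
      refine ⟨t, ⟨⟨s, hs, fun x hx => if_neg hx⟩, fun ht => hns ?_⟩,
        funext fun i => ((htz i).trans (hz' i)).symm⟩
      refine (FSat_congr (eI M) ξ fun x hx => ?_).1 ht
      rcases hfv hx with ⟨j, rfl⟩ | ⟨i, rfl⟩
      · exact htv j
      · exact htz i
    · exact (flat W).2 fun t ht => (FSat_nneg (eI M) ξ t).2 ht.2
    · obtain ⟨s, hs, hts⟩ := ht.1
      exact ⟨s, ⟨hs, t, ht, hts⟩, hts⟩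


end DSFO
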